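/- Let (X, 𝒜, μ) be a probability space, (Y, ℬ) a measurable space, and κ a Markov kernel from X to Y; let ν := μ ⊗ κ. Let g : X × Y → ℝ^d be jointly measurable, let c : X → [0,1] be measurable, fix τ ∈ [0,1), set w(x) := 1[c(x) ≥ τ], and suppose β := μ({x : c(x) ≥ τ}) = c₁ (1 − τ) with c₁ > 0, and that ‖g(x, y)‖² ≤ c₂ (1 − τ) for ν-almost every (x, y) with c(x) ≥ τ, for a constant c₂ ≥ 0. Define ĝ(x, y) := (w(x)/β) g(x, y) and m := ∫ ĝ dν. Then Var(ĝ) := ∫ ‖ĝ − m‖² dν ≤ c₂/c₁ − ‖m‖², a bound that does not depend on the threshold τ. -/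

import Mathlib

open MeasureTheory ProbabilityTheory

/-- The vector variance of a square-integrable random variable is its second moment minus the
squared norm of its mean. -/
theorem integral_norm_sub_integral_sq {Ω E : Type*} [MeasurableSpace Ω] {ν : Measure Ω}
    [IsProbabilityMeasure ν] [NormedAddCommGroup E] [InnerProductSpace ℝ E] [CompleteSpace E]
    {f : Ω → E} (hf : Integrable f ν) (hf2 : Integrable (fun ω => ‖f ω‖ ^ 2) ν) :
    ∫ ω, ‖f ω - ∫ ω', f ω' ∂ν‖ ^ 2 ∂ν = ∫ ω, ‖f ω‖ ^ 2 ∂ν - ‖∫ ω, f ω ∂ν‖ ^ 2 := by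
  set m := ∫ ω, f ω ∂ν with hm
  have hinner : ∫ ω, inner ℝ m (f ω) ∂ν = ‖m‖ ^ 2 := by
    rw [integral_inner hf m, ← hm, real_inner_self_eq_norm_sq]
  have hint : Integrable (fun ω => 2 * inner ℝ m (f ω)) ν := (hf.const_inner m).const_mul 2
  have hsub : Integrable (fun ω => ‖f ω‖ ^ 2 - 2 * inner ℝ m (f ω)) ν := hf2.sub hint
  have hexp : ∀ ω, ‖f ω - m‖ ^ 2 = ‖f ω‖ ^ 2 - 2 * inner ℝ m (f ω) + ‖m‖ ^ 2 := fun ω => by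
    rw [norm_sub_sq_real, real_inner_comm]
  simp_rw [hexp]
  rw [integral_add hsub (integrable_const _), integral_sub hf2 hint,
    integral_const_mul, hinner]
  simp
  ring

/-- Stability of the confidence-aware variance bound: if `β = c₁ (1 − τ)` and
`‖g (x, y)‖² ≤ c₂ (1 − τ)` for `ν`-a.e. `(x, y)` with `c x ≥ τ`, then the
curriculum estimator `ghat (x, y) = (w x / β) • g (x, y)` with `w x = 1[c x ≥ τ]`
and mean `m = ∫ ghat dν` satisfies `Var(ghat) ≤ c₂/c₁ − ‖m‖²`, a bound
independent of the threshold `τ`. -/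
theorem variance_bound_stable_in_threshold
    {X Y : Type*} [MeasurableSpace X] [MeasurableSpace Y]
    (μ : Measure X) [IsProbabilityMeasure μ]
    (κ : Kernel X Y) [IsMarkovKernel κ]
    {d : ℕ} (g : X × Y → EuclideanSpace ℝ (Fin d)) (hg : Measurable g)
    (c : X → ℝ) (hc : Measurable c) (hc01 : ∀ x, c x ∈ Set.Icc (0 : ℝ) 1)
    (τ : ℝ) (hτ : τ ∈ Set.Ico (0 : ℝ) 1)
    (w : X → ℝ) (hw : w = fun x => if τ ≤ c x then (1 : ℝ) else 0)
    (c₁ : ℝ) (hc₁ : 0 < c₁)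
    (β : ℝ) (hβ : β = (μ {x | τ ≤ c x}).toReal) (hβc₁ : β = c₁ * (1 - τ))
    (c₂ : ℝ) (hc₂ : 0 ≤ c₂)
    (hbound : ∀ᵐ p ∂(μ ⊗ₘ κ), τ ≤ c p.1 → ‖g p‖ ^ 2 ≤ c₂ * (1 - τ))
    (ghat : X × Y → EuclideanSpace ℝ (Fin d))
    (hghat : ghat = fun p => (w p.1 / β) • g p)
    (m : EuclideanSpace ℝ (Fin d)) (hm : m = ∫ p, ghat p ∂(μ ⊗ₘ κ)) :
    (∫ p, ‖ghat p - m‖ ^ 2 ∂(μ ⊗ₘ κ)) ≤ c₂ / c₁ - ‖m‖ ^ 2 := by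
  have hτ' : 0 < 1 - τ := sub_pos.mpr hτ.2
  have hβ_pos : 0 < β := hβc₁ ▸ mul_pos hc₁ hτ'
  have hS : MeasurableSet {x | τ ≤ c x} := measurableSet_le measurable_const hc
  have hw_meas : Measurable w := hw ▸ Measurable.ite hS measurable_const measurable_const
  have hw_int : ∫ p, w p.1 ∂(μ ⊗ₘ κ) = β := by
    have hw_ind : w = {x | τ ≤ c x}.indicator 1 := by
      ext x
      simp [hw, Set.indicator_apply]
    rw [← integral_map (f := w) measurable_fst.aemeasurable hw_meas.aestronglyMeasurable,
      ← Measure.fst, Measure.fst_compProd, hw_ind, integral_indicator_one hS, hβ, measureReal_def]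
  have hw_integrable : Integrable (fun p : X × Y => w p.1) (μ ⊗ₘ κ) :=
    not_imp_comm.mp integral_undef (hw_int ▸ hβ_pos.ne')
  have hle : ∀ᵐ p ∂(μ ⊗ₘ κ), ‖ghat p‖ ^ 2 ≤ c₂ / (c₁ * β) * w p.1 := by
    filter_upwards [hbound] with p hp
    by_cases h : τ ≤ c p.1
    · have hw1 : w p.1 = 1 := by simp [hw, h]
      have hK : c₂ / (c₁ * β) = (1 / β) ^ 2 * (c₂ * (1 - τ)) := by
        rw [hβc₁]
        field_simp
      simp only [hghat, norm_smul, mul_pow, hw1, Real.norm_eq_abs, sq_abs, mul_one]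
      rw [hK]
      exact mul_le_mul_of_nonneg_left (hp h) (sq_nonneg _)
    · simp [hghat, hw, h]
  have hghat_meas : Measurable ghat := by
    rw [hghat]
    exact ((hw_meas.comp measurable_fst).div_const β).smul hg
  have hsq : Integrable (fun p => ‖ghat p‖ ^ 2) (μ ⊗ₘ κ) := by
    refine (hw_integrable.const_mul (c₂ / (c₁ * β))).mono'
      (hghat_meas.norm.pow_const 2).aestronglyMeasurable ?_
    filter_upwards [hle] with p hp
    rwa [Real.norm_of_nonneg (sq_nonneg _)]
  have hint : Integrable ghat (μ ⊗ₘ κ) :=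
    ((memLp_two_iff_integrable_sq_norm hghat_meas.aestronglyMeasurable).mpr hsq).integrable
      one_le_two
  rw [hm, integral_norm_sub_integral_sq hint hsq]
  gcongr
  calc ∫ p, ‖ghat p‖ ^ 2 ∂(μ ⊗ₘ κ)
      ≤ ∫ p, c₂ / (c₁ * β) * w p.1 ∂(μ ⊗ₘ κ) :=
        integral_mono_ae hsq (hw_integrable.const_mul _) hle
    _ = c₂ / c₁ := by
        rw [integral_const_mul, hw_int]
        field_simp
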